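/- Let n = 2ν be even, J₀ the canonical antisymmetric matrix of order n, and f : 𝕊ₙ⁺ × ℝ^{n×n} → ℝ a continuously Frechet differentiable function (𝕊ₙ⁺ the positive semi-definite symmetric n×n matrices). For P ∈ 𝕊₂ₙ partitioned into n×n blocks P = [[P₁₁, P₁₂],[P₂₁, P₂₂]] with P₂₂ positive definite, define V(P) := f(P₁₁, P₁₂ (P₂₂⁻¹ + J₀) P₂₁). Then V satisfies the partial differential equation 𝐇(H²²(P)) = 0, where Q(P) ∈ 𝕊₂ₙ is the Frobenius gradient of V at P (as a function on symmetric matrices), H(P) := Q(P) P, H²²(P) is the lower-right n×n block of H(P), and 𝐇(N) := (N + J₀ Nᵀ J₀)/2. -/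

import Mathlib

open Matrix
open scoped Kronecker

attribute [local instance] Matrix.frobeniusNormedAddCommGroup Matrix.frobeniusNormedSpace

/-- Index type for matrices of even order `n = 2ν`. -/
abbrev Idx (ν : ℕ) := Fin ν × Fin 2

/-- The canonical antisymmetric matrix `J₀ = I_ν ⊗ [[0,1],[-1,0]]` of order `n = 2ν`. -/
noncomputable def J0 (ν : ℕ) : Matrix (Idx ν) (Idx ν) ℝ :=
  (1 : Matrix (Fin ν) (Fin ν) ℝ) ⊗ₖ !![(0 : ℝ), 1; -1, 0]

/-- The subspace of real symmetric matrices indexed by `m`. -/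
def symMatI (m : Type*) [Fintype m] [DecidableEq m] : Submodule ℝ (Matrix m m ℝ) where
  carrier := {Y | Yᵀ = Y}
  add_mem' := by
    intro a b ha hb
    simp only [Set.mem_setOf_eq] at *
    rw [Matrix.transpose_add, ha, hb]
  zero_mem' := by simp
  smul_mem' := by
    intro c a ha
    simp only [Set.mem_setOf_eq] at *
    rw [Matrix.transpose_smul, ha]

lemma mem_symMatI {m : Type*} [Fintype m] [DecidableEq m] {A : Matrix m m ℝ} :
    A ∈ symMatI m ↔ Aᵀ = A :=
  Iff.rfl

/-- The function `V(P) := f(P₁₁, P₁₂ (P₂₂⁻¹ + J₀) P₂₁)` on symmetric `2n × 2n` matrices. -/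
noncomputable def Vfun (ν : ℕ)
    (f : symMatI (Idx ν) × Matrix (Idx ν) (Idx ν) ℝ → ℝ)
    (P : symMatI (Idx ν ⊕ Idx ν)) : ℝ :=
  f (⟨toBlocks₁₁ (P : Matrix (Idx ν ⊕ Idx ν) (Idx ν ⊕ Idx ν) ℝ), by
      have h2 : (P : Matrix (Idx ν ⊕ Idx ν) (Idx ν ⊕ Idx ν) ℝ)ᵀ = P := P.2
      rw [mem_symMatI]
      ext i j
      have := congrFun (congrFun h2 (Sum.inl i)) (Sum.inl j)
      simpa [Matrix.toBlocks₁₁, Matrix.transpose_apply] using this⟩,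
    toBlocks₁₂ (P : Matrix (Idx ν ⊕ Idx ν) (Idx ν ⊕ Idx ν) ℝ) *
      ((toBlocks₂₂ (P : Matrix (Idx ν ⊕ Idx ν) (Idx ν ⊕ Idx ν) ℝ))⁻¹ + J0 ν) *
      toBlocks₂₁ (P : Matrix (Idx ν ⊕ Idx ν) (Idx ν ⊕ Idx ν) ℝ))

lemma J0_transpose (ν : ℕ) : (J0 ν)ᵀ = -J0 ν := by
  ext ⟨i, a⟩ ⟨j, b⟩
  fin_cases a <;> fin_cases b <;>
    simp [J0, Matrix.kroneckerMap_apply, Matrix.one_apply, eq_comm]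

lemma J0_mul_J0 (ν : ℕ) : J0 ν * J0 ν = -1 := by
  have h : !![(0 : ℝ), 1; -1, 0] * !![(0 : ℝ), 1; -1, 0] = (-1 : ℝ) • 1 := by
    ext a b
    fin_cases a <;> fin_cases b <;> simp [Matrix.mul_apply]
  rw [J0, ← Matrix.mul_kronecker_mul, h, Matrix.kronecker_smul, one_mul,
    Matrix.one_kronecker_one, neg_one_smul]

/-- A matrix that is Frobenius orthogonal to its Hamiltonian part has vanishing Hamiltonian
part. -/
lemma hamiltonian_part_eq_zero {m : Type*} [Fintype m] [DecidableEq m] {J N : Matrix m m ℝ}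
    (hJt : Jᵀ = -J) (hJJ : J * J = -1) (h : (Nᵀ * (N + J * Nᵀ * J)).trace = 0) :
    N + J * Nᵀ * J = 0 := by
  set τ := N + J * Nᵀ * J with hτ
  have hτt : τᵀ = J * τ * J := by
    have e : J * τ * J = J * N * J + (J * J) * Nᵀ * (J * J) := by
      rw [hτ]; noncomm_ring
    rw [e, hJJ, hτ]
    simp only [transpose_add, transpose_mul, transpose_transpose, hJt]
    noncomm_ring
  have h2 : ((J * Nᵀ * J)ᵀ * τ).trace = 0 := by
    calc ((J * Nᵀ * J)ᵀ * τ).trace = (J * (N * J * τ)).trace := by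
          simp only [transpose_mul, transpose_transpose, hJt]
          congr 1; noncomm_ring
      _ = (N * τᵀ).trace := by
          rw [trace_mul_comm, hτt]; congr 1; noncomm_ring
      _ = (Nᵀ * τ).trace := by
          rw [← trace_transpose, transpose_mul, transpose_transpose, trace_mul_comm]
      _ = 0 := h
  have h3 : (τᵀ * τ).trace = 0 := by
    have : τᵀ * τ = Nᵀ * τ + (J * Nᵀ * J)ᵀ * τ := by
      rw [← add_mul, ← transpose_add]
    rw [this, trace_add, h, h2, add_zero]
  exact (trace_conjTranspose_mul_self_eq_zero_iff (A := τ)).1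
    (by rwa [conjTranspose_eq_transpose_of_trivial])

/-- How `P₁₂ (P₂₂⁻¹ + J) P₂₁` changes under a congruence acting on the second block. -/
lemma congruence_second_block {m n : Type*} [Fintype m] [DecidableEq m]
    {J A σ : Matrix m m ℝ} (B : Matrix n m ℝ) (C : Matrix m n ℝ) (hσ : IsUnit σ.det) :
    B * σᵀ * ((σ * A * σᵀ)⁻¹ + J) * (σ * C) = B * (A⁻¹ + σᵀ * J * σ) * C := by
  have hσt : IsUnit σᵀ.det := by rwa [det_transpose]
  have e : σᵀ * (σ * A * σᵀ)⁻¹ * σ = A⁻¹ := by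
    rw [Matrix.mul_inv_rev, Matrix.mul_inv_rev, ← Matrix.mul_assoc, Matrix.mul_nonsing_inv _ hσt,
      Matrix.one_mul, Matrix.mul_assoc, Matrix.nonsing_inv_mul _ hσ, Matrix.mul_one]
  rw [← e]
  simp only [Matrix.mul_add, Matrix.add_mul, Matrix.mul_assoc]

/-- Derivative at `0` of a function along a quadratic curve. -/
lemma hasDerivAt_comp_quadratic {E : Type*} [NormedAddCommGroup E] [NormedSpace ℝ E]
    {F : E → ℝ} {L : E →L[ℝ] ℝ} {x : E} (hF : HasFDerivAt F L x) (v w : E) :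
    HasDerivAt (fun t : ℝ => F (x + t • v + t ^ 2 • w)) (L v) 0 := by
  have h1 : HasDerivAt (fun t : ℝ => x + t • v + t ^ 2 • w) v 0 := by
    have := (((hasDerivAt_id (0 : ℝ)).smul_const v).const_add x).add
      ((hasDerivAt_pow 2 (0 : ℝ)).smul_const w)
    simpa [Pi.add_def] using this
  have hF' : HasFDerivAt F L (x + (0 : ℝ) • v + (0 : ℝ) ^ 2 • w) := by simpa using hF
  exact hF'.comp_hasDerivAt (0 : ℝ) h1

lemma eventually_isUnit_det_one_add_smul {m : Type*} [Fintype m] [DecidableEq m]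
    (τ : Matrix m m ℝ) : ∀ᶠ t : ℝ in nhds 0, IsUnit (1 + t • τ).det := by
  have hc : Continuous fun t : ℝ => (1 + t • τ).det := by fun_prop
  have h0 : (1 + (0 : ℝ) • τ).det ≠ 0 := by simp
  filter_upwards [hc.continuousAt.eventually_ne h0] with t ht
  exact isUnit_iff_ne_zero.2 ht

theorem stmt_14 (ν : ℕ)
    (f : symMatI (Idx ν) × Matrix (Idx ν) (Idx ν) ℝ → ℝ)
    -- f is continuously Frechet differentiable
    (hf : ContDiff ℝ 1 f)
    (P : symMatI (Idx ν ⊕ Idx ν))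
    -- the lower-right block P₂₂ is positive definite
    (hP22 : (toBlocks₂₂ (P : Matrix (Idx ν ⊕ Idx ν) (Idx ν ⊕ Idx ν) ℝ)).PosDef)
    -- Q(P) is the Frobenius gradient of V at P
    (Q : symMatI (Idx ν ⊕ Idx ν))
    (L : symMatI (Idx ν ⊕ Idx ν) →L[ℝ] ℝ)
    (hd : HasFDerivAt (Vfun ν f) L P)
    (hrep : ∀ δ : symMatI (Idx ν ⊕ Idx ν),
      L δ = ((Q : Matrix (Idx ν ⊕ Idx ν) (Idx ν ⊕ Idx ν) ℝ)ᵀ *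
        (δ : Matrix (Idx ν ⊕ Idx ν) (Idx ν ⊕ Idx ν) ℝ)).trace) :
    -- the PDE 𝐇(H²²(P)) = 0 with H(P) := Q(P) P
    (1 / 2 : ℝ) •
      (toBlocks₂₂ ((Q : Matrix (Idx ν ⊕ Idx ν) (Idx ν ⊕ Idx ν) ℝ) *
          (P : Matrix (Idx ν ⊕ Idx ν) (Idx ν ⊕ Idx ν) ℝ)) +
        J0 ν * (toBlocks₂₂ ((Q : Matrix (Idx ν ⊕ Idx ν) (Idx ν ⊕ Idx ν) ℝ) *
          (P : Matrix (Idx ν ⊕ Idx ν) (Idx ν ⊕ Idx ν) ℝ)))ᵀ * J0 ν) = 0 := by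
  set p : Matrix (Idx ν ⊕ Idx ν) (Idx ν ⊕ Idx ν) ℝ := P.1 with hp
  set q : Matrix (Idx ν ⊕ Idx ν) (Idx ν ⊕ Idx ν) ℝ := Q.1 with hq
  have hpt : pᵀ = p := P.2
  have hqt : qᵀ = q := Q.2
  set N := toBlocks₂₂ (q * p) with hN
  set τ := N + J0 ν * Nᵀ * J0 ν with hτ
  set T : Matrix (Idx ν ⊕ Idx ν) (Idx ν ⊕ Idx ν) ℝ := fromBlocks 0 0 0 τ with hT
  let δ : symMatI (Idx ν ⊕ Idx ν) := ⟨T * p + p * Tᵀ, by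
    rw [mem_symMatI]; simp [transpose_mul, hpt, add_comm]⟩
  let ε : symMatI (Idx ν ⊕ Idx ν) := ⟨T * p * Tᵀ, by
    rw [mem_symMatI]; simp [transpose_mul, hpt, Matrix.mul_assoc]⟩
  have hτJ : τᵀ * J0 ν + J0 ν * τ = 0 := by
    have e : τᵀ * J0 ν + J0 ν * τ =
        Nᵀ * J0 ν + J0 ν * N * (J0 ν * J0 ν) + J0 ν * N + (J0 ν * J0 ν) * Nᵀ * J0 ν := by
      rw [hτ]
      simp only [transpose_add, transpose_mul, transpose_transpose, J0_transpose]
      noncomm_ring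
    rw [e, J0_mul_J0]
    noncomm_ring
  have hLδ : L δ = 0 := by
    set x : symMatI (Idx ν) × Matrix (Idx ν) (Idx ν) ℝ :=
      (⟨toBlocks₁₁ p, by
        rw [mem_symMatI]
        ext i j
        exact congrFun (congrFun hpt (Sum.inl i)) (Sum.inl j)⟩,
      toBlocks₁₂ p * ((toBlocks₂₂ p)⁻¹ + J0 ν) * toBlocks₂₁ p) with hx
    have hfx := (hf.differentiable one_ne_zero x).hasFDerivAt
    have hd1 := hasDerivAt_comp_quadratic hd δ ε
    have hd2 := hasDerivAt_comp_quadratic hfx 0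
      (0, toBlocks₁₂ p * (τᵀ * J0 ν * τ) * toBlocks₂₁ p)
    rw [map_zero] at hd2
    refine hd1.unique (hd2.congr_of_eventuallyEq ?_)
    filter_upwards [eventually_isUnit_det_one_add_smul τ] with t ht
    set σ := 1 + t • τ with hσ
    have hcurve : ((P + t • δ + t ^ 2 • ε : symMatI (Idx ν ⊕ Idx ν)) :
          Matrix (Idx ν ⊕ Idx ν) (Idx ν ⊕ Idx ν) ℝ) =
        fromBlocks (toBlocks₁₁ p) (toBlocks₁₂ p * σᵀ) (σ * toBlocks₂₁ p)
          (σ * toBlocks₂₂ p * σᵀ) := by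
      have h1 : ((P + t • δ + t ^ 2 • ε : symMatI (Idx ν ⊕ Idx ν)) :
          Matrix (Idx ν ⊕ Idx ν) (Idx ν ⊕ Idx ν) ℝ) = (1 + t • T) * p * (1 + t • T)ᵀ := by
        change p + t • (T * p + p * Tᵀ) + t ^ 2 • (T * p * Tᵀ) = _
        simp only [transpose_add, transpose_smul, transpose_one, add_mul, mul_add, one_mul,
          mul_one, smul_mul_assoc, mul_smul_comm, smul_add, smul_smul, pow_two]
        abel
      have h2 : 1 + t • T = fromBlocks 1 0 0 σ := by
        rw [hT, hσ, ← fromBlocks_one, fromBlocks_smul, fromBlocks_add]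
        simp
      rw [h1, h2]
      conv_lhs => rw [← fromBlocks_toBlocks p]
      simp [fromBlocks_multiply, fromBlocks_transpose]
    have hσJ : σᵀ * J0 ν * σ = J0 ν + t ^ 2 • (τᵀ * J0 ν * τ) := by
      have e : σᵀ * J0 ν * σ =
          J0 ν + t • (τᵀ * J0 ν + J0 ν * τ) + t ^ 2 • (τᵀ * J0 ν * τ) := by
        rw [hσ]
        simp only [transpose_add, transpose_smul, transpose_one, add_mul, mul_add, one_mul,
          mul_one, smul_mul_assoc, mul_smul_comm, smul_add, smul_smul, pow_two]
        abel
      rw [e, hτJ, smul_zero, add_zero]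
    rw [Vfun]
    congr 1
    refine Prod.ext (Subtype.ext ?_) ?_
    · simp [hcurve, hx]
    · simp only [hcurve, toBlocks_fromBlocks₁₂, toBlocks_fromBlocks₂₁, toBlocks_fromBlocks₂₂]
      rw [congruence_second_block _ _ ht, hσJ]
      simp [hx, Matrix.mul_add, Matrix.add_mul, add_assoc]
  have htr : (Nᵀ * τ).trace = 0 := by
    have h1 : (qᵀ * (T * p + p * Tᵀ)).trace = 0 := (hrep δ).symm.trans hLδ
    have h2 : (q * (p * Tᵀ)).trace = (q * (T * p)).trace := by
      rw [← trace_transpose (q * (T * p)), transpose_mul, transpose_mul, hqt, hpt, trace_mul_comm]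
    have h3 : (q * (T * p)).trace = (Nᵀ * τ).trace := by
      have h4 : (q * p)ᵀ * T = fromBlocks 0 ((toBlocks₂₁ (q * p))ᵀ * τ) 0 (Nᵀ * τ) := by
        conv_lhs => rw [← fromBlocks_toBlocks (q * p)]
        simp [hT, fromBlocks_transpose, fromBlocks_multiply, hN]
      rw [← Matrix.mul_assoc, trace_mul_comm, ← Matrix.mul_assoc]
      rw [transpose_mul, hqt, hpt] at h4
      rw [h4]
      simp [trace, Fintype.sum_sum_type]
    rw [hqt, mul_add, trace_add, h2, h3] at h1
    linarith
  rw [hτ, hamiltonian_part_eq_zero (J0_transpose ν) (J0_mul_J0 ν) htr, smul_zero]
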